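/- Let J ⊂ B_0(m,k) be the two-sided ideal generated by the elements L_{i+1}·L_i, R_i·R_{i+1}, and I_x·U_j for all states x with x ∩ {j−1,j} = ∅. Then for all idempotent states x and y, I_x·J·I_y = φ^{x,y}(I(x,y)), where I(x,y) ⊂ F_2[U_1,...,U_m] is the following ideal: I(x,y) = F_2[U_1,...,U_m] if x and y are far (some |x_j − y_j| > 1); otherwise I(x,y) is generated by the monomials U_{i+1}···U_j taken over all generating intervals [i+1,j] for (x,y), i.e. pairs 0 ≤ i < j ≤ m such that i, j ∉ x ∩ y, every integer t with i < t < j lies in x ∩ y, and w^{x,y}_t = 0 for all i+1 ≤ t ≤ j. -/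

import Mathlib

/-- Idempotent states: `k`-element subsets of `{0,1,...,m}`. -/
abbrev IdemState (m k : ℕ) := {x : Finset (Fin (m + 1)) // x.card = k}

/-- The weight `v^x` at coordinate `c : Fin m`, representing the paper's
`v^x_{c+1} = #{a ∈ x : a ≥ c+1}` (coordinate `c` corresponds to the strand
labelled `c+1`). -/
def vwt {m : ℕ} (x : Finset (Fin (m + 1))) (c : Fin m) : ℕ :=
  (x.filter (fun a => (c : ℕ) < a.val)).card

/-- Twice the minimal relative weight: `2·w^{x,y}_{c+1} = |v^x_{c+1} − v^y_{c+1}|`. -/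
def wnum {m : ℕ} (x y : Finset (Fin (m + 1))) (c : Fin m) : ℕ :=
  ((vwt x c : ℤ) - (vwt y c : ℤ)).natAbs

/-- Basis elements of `B₀(m,k)`: a pair of idempotent states together with a
monomial `U_1^{s_1} ⋯ U_m^{s_m}` (recorded by its exponents); the basis element
is `φ^{x,y}(U^s)`. -/
structure BGen (m k : ℕ) where
  l : IdemState m k
  r : IdemState m k
  s : Fin m → ℕ
deriving DecidableEq

/-- The exponents `t_i = w^{x,y}_i + w^{y,z}_i − w^{x,z}_i` of the correction
monomial `g^{x,y,z} = U_1^{t_1} ⋯ U_m^{t_m}`. -/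
def texp {m k : ℕ} (x y z : IdemState m k) (c : Fin m) : ℕ :=
  (wnum x.1 y.1 c + wnum y.1 z.1 c - wnum x.1 z.1 c) / 2

/-- The product of two basis elements of `B₀(m,k)`:
`φ^{x,y}(U^s) * φ^{y',z}(U^{s'})` is zero (i.e. `none`) unless `y = y'`, in
which case it equals `φ^{x,z}(U^s · U^{s'} · g^{x,y,z})`. -/
def mulBGen {m k : ℕ} (a b : BGen m k) : Option (BGen m k) :=
  if a.r = b.l then
    some ⟨a.l, b.r, fun c => a.s c + b.s c + texp a.l a.r b.r c⟩
  else none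

/-- The underlying `F₂`-vector space of the algebra `B₀(m,k)`: formal `F₂`-linear
combinations of the basis elements `φ^{x,y}(U^s)`. -/
def B0 (m k : ℕ) : Type := BGen m k →₀ ZMod 2

noncomputable instance {m k : ℕ} : AddCommGroup (B0 m k) :=
  inferInstanceAs (AddCommGroup (BGen m k →₀ ZMod 2))

/-- View an element of `B₀(m,k)` as a finitely supported function. -/
def B0.toF {m k : ℕ} (f : B0 m k) : BGen m k →₀ ZMod 2 := f

/-- The multiplication of `B₀(m,k)`, the bilinear extension of `mulBGen`. -/
noncomputable def mulB {m k : ℕ} (f g : B0 m k) : B0 m k :=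
  (B0.toF f).sum fun a ca =>
    (B0.toF g).sum fun b cb =>
      match mulBGen a b with
      | some c => Finsupp.single c (ca * cb)
      | none => 0

noncomputable instance {m k : ℕ} : Mul (B0 m k) := ⟨mulB⟩

/-- The basis element `φ^{x,y}(U^s)` of `B₀(m,k)`. -/
noncomputable def bElt {m k : ℕ} (g : BGen m k) : B0 m k := Finsupp.single g 1

/-- The basic idempotent `I_x ∈ B₀(m,k)`. -/
noncomputable def idemElt {m k : ℕ} (x : IdemState m k) : B0 m k :=
  bElt ⟨x, x, fun _ => 0⟩

/-- The central element `U_i = Σ_x φ^{x,x}(U_i)`; the index `i : Fin m`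
corresponds to the paper's `U_{i+1}`. -/
noncomputable def UElt {m k : ℕ} (i : Fin m) : B0 m k :=
  ∑ x : IdemState m k, bElt (⟨x, x, fun c => if c = i then 1 else 0⟩ : BGen m k)

/-- The right-shift `R = Σ R^x`, moving an occupied position from `i` to `i+1`
(the paper's `R_{i+1}`). -/
noncomputable def RElt {m k : ℕ} (i : Fin m) : B0 m k :=
  ∑ p : IdemState m k × IdemState m k,
    if i.castSucc ∈ p.1.1 ∧ i.succ ∉ p.1.1 ∧
        p.2.1 = insert i.succ (p.1.1.erase i.castSucc) then
      bElt (⟨p.1, p.2, fun _ => 0⟩ : BGen m k)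
    else 0

/-- The left-shift `L = Σ L^y`, moving an occupied position from `i+1` to `i`
(the paper's `L_{i+1}`). -/
noncomputable def LElt {m k : ℕ} (i : Fin m) : B0 m k :=
  ∑ p : IdemState m k × IdemState m k,
    if i.succ ∈ p.1.1 ∧ i.castSucc ∉ p.1.1 ∧
        p.2.1 = insert i.castSucc (p.1.1.erase i.succ) then
      bElt (⟨p.1, p.2, fun _ => 0⟩ : BGen m k)
    else 0

/-- The generating set of the two-sided ideal `J`: the elements
`L_{i+1}·L_i`, `R_i·R_{i+1}`, and `I_x·U_j` for states `x` with
`x ∩ {j−1, j} = ∅`. -/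
def JGenerators (m k : ℕ) : Set (B0 m k) :=
  {z | ∃ i i' : Fin m, (i' : ℕ) = (i : ℕ) + 1 ∧
        (z = LElt i' * LElt i ∨ z = RElt i * RElt i')} ∪
  {z | ∃ (j : Fin m) (x : IdemState m k),
        j.castSucc ∉ x.1 ∧ j.succ ∉ x.1 ∧ z = idemElt x * UElt j}

/-- The two-sided ideal `J ⊆ B₀(m,k)` generated by `JGenerators`:  since
`B₀(m,k)` is unital, it is the additive subgroup generated by all products
`a·g·b` with `g` a generator. -/
noncomputable def JIdeal (m k : ℕ) : AddSubgroup (B0 m k) :=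
  AddSubgroup.closure {z | ∃ g ∈ JGenerators m k, ∃ a b : B0 m k, z = a * g * b}

/-- The map `φ^{x,y} : F₂[U_1,...,U_m] → I_x·B₀(m,k)·I_y`. -/
noncomputable def phiMap {m k : ℕ} (x y : IdemState m k)
    (p : MvPolynomial (Fin m) (ZMod 2)) : B0 m k :=
  ∑ d ∈ p.support, Finsupp.single (⟨x, y, fun c => d c⟩ : BGen m k) (MvPolynomial.coeff d p)

/-- Two idempotent states are *far* if some pair of corresponding entries of
their increasing enumerations differs by more than `1`. -/
def FarStates {m k : ℕ} (x y : IdemState m k) : Prop :=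
  ∃ j : Fin k,
    1 < |(((x.1.orderIsoOfFin x.2 j : Fin (m + 1)) : ℕ) : ℤ) -
          (((y.1.orderIsoOfFin y.2 j : Fin (m + 1)) : ℕ) : ℤ)|

/-- `[i+1, j]` is a *generating interval* for `(x, y)`: here `0 ≤ i < j ≤ m`,
`i, j ∉ x ∩ y`, every `t` with `i < t < j` lies in `x ∩ y`, and `w^{x,y}_t = 0`
for all `i+1 ≤ t ≤ j` (a paper index `t` corresponds to the coordinate
`c = t − 1 : Fin m`). -/
def GenInterval {m k : ℕ} (x y : IdemState m k) (i j : ℕ) : Prop :=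
  i < j ∧ j ≤ m ∧
  (∀ a : Fin (m + 1), (a.val = i ∨ a.val = j) → ¬(a ∈ x.1 ∧ a ∈ y.1)) ∧
  (∀ a : Fin (m + 1), i < a.val → a.val < j → a ∈ x.1 ∧ a ∈ y.1) ∧
  (∀ c : Fin m, i ≤ (c : ℕ) → (c : ℕ) < j → wnum x.1 y.1 c = 0)

/-- The monomial `U_{i+1} ⋯ U_j` associated to a generating interval. -/
noncomputable def intervalMonomial {m : ℕ} (i j : ℕ) : MvPolynomial (Fin m) (ZMod 2) :=
  ∏ c ∈ Finset.univ.filter (fun c : Fin m => i ≤ (c : ℕ) ∧ (c : ℕ) < j),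
    MvPolynomial.X c

open Classical in
/-- The ideal `I(x,y) ⊆ F₂[U_1,...,U_m]`: everything if `x` and `y` are far,
and otherwise the ideal generated by the monomials of the generating intervals
for `(x,y)`. -/
noncomputable def IIdeal {m k : ℕ} (x y : IdemState m k) :
    Ideal (MvPolynomial (Fin m) (ZMod 2)) :=
  if FarStates x y then ⊤
  else Ideal.span {q | ∃ i j : ℕ, GenInterval x y i j ∧ q = intervalMonomial i j}

/-- Integer sequences that drop by `0` or `1` at each step. -/
def IsStair (a : ℤ → ℤ) : Prop := ∀ t, a (t + 1) ≤ a t ∧ a t ≤ a (t + 1) + 1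

/-- Both sequences drop at `t`. -/
def DropBoth (a c : ℤ → ℤ) (t : ℤ) : Prop := a t = a (t + 1) + 1 ∧ c t = c (t + 1) + 1

/-- The sequence form of the negation of `FarStates`. -/
def Interlaced (a c : ℤ → ℤ) : Prop := ∀ t, a (t + 1) ≤ c t ∧ c (t + 1) ≤ a t

/-- A generating interval for `(a, c)` starting at or before `s` can be closed to the right of `s`,
inside `S`. -/
def RightEnd (a c : ℤ → ℤ) (S : ℤ → Prop) (s : ℤ) : Prop :=
  ∃ j, s ≤ j ∧ ¬DropBoth a c j ∧ (∀ t, s ≤ t → t < j → DropBoth a c t) ∧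
    ∀ t, s ≤ t → t ≤ j → a t = c t ∧ S t

/-- A generating interval for `(a, c)` ending at or after `s` can be closed to the left of `s`,
inside `S`. -/
def LeftEnd (a c : ℤ → ℤ) (S : ℤ → Prop) (s : ℤ) : Prop :=
  ∃ i, i < s ∧ ¬DropBoth a c i ∧ (∀ t, i < t → t < s → DropBoth a c t) ∧
    ∀ t, i < t → t ≤ s → a t = c t ∧ S t

/-- `[i + 1, j]` is a generating interval for the sequences `(a, c)`. -/
def IsInterval (a c : ℤ → ℤ) (i j : ℤ) : Prop :=
  i < j ∧ ¬DropBoth a c i ∧ ¬DropBoth a c j ∧ (∀ t, i < t → t < j → DropBoth a c t) ∧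
    ∀ t, i < t → t ≤ j → a t = c t

/-- Some generating interval for `(a, c)` is contained in `S`. -/
def HasInterval (a c : ℤ → ℤ) (S : ℤ → Prop) : Prop :=
  ∃ i j, IsInterval a c i j ∧ ∀ t, i < t → t ≤ j → S t

/-- The reflection of a sequence. -/
def reflect (a : ℤ → ℤ) (t : ℤ) : ℤ := -a (-t)

theorem IsStair.reflect {a : ℤ → ℤ} (ha : IsStair a) : IsStair (reflect a) := by
  intro t
  have h := ha (-(t + 1))
  have e : -(t + 1) + 1 = -t := by ring
  rw [e] at h
  simp only [_root_.reflect]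
  omega

theorem Interlaced.reflect {a c : ℤ → ℤ} (h : Interlaced a c) :
    Interlaced (reflect a) (reflect c) := by
  intro t
  have h := h (-(t + 1))
  have e : -(t + 1) + 1 = -t := by ring
  rw [e] at h
  simp only [_root_.reflect]
  omega

theorem reflect_reflect (a : ℤ → ℤ) : reflect (reflect a) = a := by
  funext t; simp [reflect]

theorem dropBoth_reflect {a c : ℤ → ℤ} {t u : ℤ} (h : t + u = -1) :
    DropBoth (reflect a) (reflect c) t ↔ DropBoth a c u := by
  obtain rfl : u = -(t + 1) := by omega
  have e : -(t + 1) + 1 = -t := by ring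
  simp only [DropBoth, reflect, e]
  omega

theorem LeftEnd.of_reflect {a c : ℤ → ℤ} {S : ℤ → Prop} {s : ℤ}
    (h : RightEnd (reflect a) (reflect c) (fun t => S (-t)) (-s)) : LeftEnd a c S s := by
  obtain ⟨j, h1, h2, h3, h4⟩ := h
  refine ⟨-j - 1, by omega, ?_, fun t ht ht' => ?_, fun t ht ht' => ?_⟩
  · rwa [dropBoth_reflect (u := -j - 1) (by ring)] at h2
  · exact (dropBoth_reflect (t := -t - 1) (by ring)).1 (h3 _ (by omega) (by omega))
  · have := h4 (-t) (by omega) (by omega)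
    simpa [reflect] using this

theorem IsInterval.reflect {a c : ℤ → ℤ} {i j : ℤ} (h : IsInterval a c i j) :
    IsInterval (reflect a) (reflect c) (-j - 1) (-i - 1) := by
  obtain ⟨h0, h1, h2, h3, h4⟩ := h
  refine ⟨by omega, ?_, ?_, fun t ht ht' => ?_, fun t ht ht' => ?_⟩
  · rwa [dropBoth_reflect (u := j) (by ring)]
  · rwa [dropBoth_reflect (u := i) (by ring)]
  · exact (dropBoth_reflect (u := -t - 1) (by ring)).2 (h3 _ (by omega) (by omega))
  · simp only [_root_.reflect, h4 (-t) (by omega) (by omega)]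

theorem HasInterval.reflect {a c : ℤ → ℤ} {S : ℤ → Prop} (h : HasInterval a c S) :
    HasInterval (reflect a) (reflect c) (fun t => S (-t)) := by
  obtain ⟨i, j, h, hS⟩ := h
  exact ⟨_, _, h.reflect, fun t ht ht' => hS _ (by omega) (by omega)⟩

theorem HasInterval.of_reflect {a c : ℤ → ℤ} {S : ℤ → Prop}
    (h : HasInterval (_root_.reflect a) (_root_.reflect c) (fun t => S (-t))) :
    HasInterval a c S := by
  simpa [reflect_reflect] using h.reflect

theorem HasInterval.of_ends {a c : ℤ → ℤ} {S : ℤ → Prop} {s : ℤ} (hl : LeftEnd a c S s)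
    (hr : RightEnd a c S s) : HasInterval a c S := by
  obtain ⟨i, hi, hi1, hi2, hi3⟩ := hl
  obtain ⟨j, hj, hj1, hj2, hj3⟩ := hr
  have key : ∀ t, i < t → t ≤ j → a t = c t ∧ S t := fun t ht ht' => by
    rcases le_total t s with h | h
    exacts [hi3 t ht h, hj3 t h ht']
  refine ⟨i, j, ⟨by omega, hi1, hj1, fun t ht ht' => ?_, fun t ht ht' => (key t ht ht').1⟩,
    fun t ht ht' => (key t ht ht').2⟩
  rcases lt_or_ge t s with h | h
  exacts [hi2 t ht h, hj2 t h ht']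

theorem RightEnd.of_not_dropBoth {a c : ℤ → ℤ} {S : ℤ → Prop} {s : ℤ} (h : ¬DropBoth a c s)
    (he : a s = c s) (hS : S s) : RightEnd a c S s := by
  refine ⟨s, le_rfl, h, fun t _ _ => by omega, fun t _ _ => ?_⟩
  obtain rfl : t = s := by omega
  exact ⟨he, hS⟩

theorem RightEnd.of_succ {a c : ℤ → ℤ} {S : ℤ → Prop} {s : ℤ} (he : a s = c s) (hS : S s)
    (h : DropBoth a c s → RightEnd a c S (s + 1)) : RightEnd a c S s := by
  by_cases hd : DropBoth a c s
  · obtain ⟨j, h1, h2, h3, h4⟩ := h hd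
    refine ⟨j, by omega, h2, fun t ht ht' => ?_, fun t ht ht' => ?_⟩
    · rcases ht.eq_or_lt with rfl | h
      exacts [hd, h3 t h ht']
    · rcases ht.eq_or_lt with rfl | h
      exacts [⟨he, hS⟩, h4 t h ht']
  · exact .of_not_dropBoth hd he hS

theorem LeftEnd.of_not_dropBoth {a c : ℤ → ℤ} {S : ℤ → Prop} {s : ℤ} (h : ¬DropBoth a c s)
    (he : a (s + 1) = c (s + 1)) (hS : S (s + 1)) : LeftEnd a c S (s + 1) := by
  refine ⟨s, by omega, h, fun t _ _ => by omega, fun t _ _ => ?_⟩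
  obtain rfl : t = s + 1 := by omega
  exact ⟨he, hS⟩

/-- Induction towards a bound `N` from below. -/
theorem int_induction_to {P : ℤ → Prop} (N : ℤ) (h1 : ∀ t, N ≤ t → P t)
    (h2 : ∀ t, P (t + 1) → P t) (s : ℤ) : P s := by
  obtain ⟨n, hn⟩ : ∃ n : ℕ, N ≤ s + n := ⟨(N - s).toNat, by omega⟩
  induction n generalizing s with
  | zero => exact h1 s (by simpa using hn)
  | succ n ih => exact h2 s (ih (s + 1) (by push_cast at hn; omega))

theorem rightEnd_of_lt {a b c : ℤ → ℤ} {S : ℤ → Prop} {N : ℤ} (hb : IsStair b)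
    (hN : ∀ t, N ≤ t → b t ≤ a t) (hS : ∀ t, a t < b t → c t < b t → S t) (s : ℤ)
    (he : a s = c s) (hlt : a s < b s) : RightEnd a c S s := by
  revert he hlt
  induction s using int_induction_to N with
  | h1 t ht => intro _ h; have := hN t ht; omega
  | h2 t ih =>
    intro he hlt
    refine .of_succ he (hS t hlt (he ▸ hlt)) fun hd => ih ?_ ?_
    · have := hd.1; have := hd.2; omega
    · have := hd.1; have := hb t; omega

theorem hasInterval_of_lt {a b c : ℤ → ℤ} {S : ℤ → Prop} {N : ℤ} (ha : IsStair a)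
    (hb : IsStair b) (hc : IsStair c) (hac : Interlaced a c) (hN : ∀ t, N ≤ t → b t ≤ a t)
    (hS : ∀ t, a t < b t → c t < b t → S t) (s : ℤ) (h : a (s + 1) = c (s + 1) → ¬DropBoth a c s)
    (h1 : a (s + 1) < b (s + 1)) (h2 : c (s + 1) < b (s + 1)) : HasInterval a c S := by
  revert h h1 h2
  induction s using int_induction_to N with
  | h1 t ht => intro _ h; have := hN (t + 1) (by omega); omega
  | h2 t ih =>
    intro h h1 h2
    by_cases he : a (t + 1) = c (t + 1)
    · exact .of_ends (.of_not_dropBoth (h he) he (hS _ h1 h2)) (rightEnd_of_lt hb hN hS _ he h1)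
    · have := ha (t + 1); have := hb (t + 1); have := hc (t + 1); have := hac (t + 1)
      refine ih (fun h' hd => ?_) (by omega) (by omega)
      obtain ⟨_, _⟩ := hd
      omega

theorem hasInterval_of_add_one_lt {a b c : ℤ → ℤ} {S : ℤ → Prop} {N : ℤ} (ha : IsStair a)
    (hb : IsStair b) (hc : IsStair c) (hac : Interlaced a c) (hN : ∀ t, N ≤ t → b t ≤ a t)
    (hS : ∀ t, a t < b t → c t < b t → S t) (s : ℤ)
    (h1 : a s + 1 < b s) (h2 : c s + 1 < b s) : HasInterval a c S := by
  revert h1 h2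
  induction s using int_induction_to N with
  | h1 t ht => intro h; have := hN t (by omega); omega
  | h2 t ih =>
    intro h1 h2
    have := ha t; have := hb t; have := hc t
    by_cases hd : DropBoth a c t
    · obtain ⟨_, _⟩ := hd
      exact ih (by omega) (by omega)
    · exact hasInterval_of_lt ha hb hc hac hN hS t (fun _ => hd) (by omega) (by omega)

theorem hasInterval_of_gap {a b c : ℤ → ℤ} {S : ℤ → Prop} {N : ℤ} (ha : IsStair a)
    (hb : IsStair b) (hc : IsStair c) (hac : Interlaced a c) (hN : ∀ t, N ≤ t → b t ≤ a t)
    (hS : ∀ t, a t < b t → c t < b t → S t) (p : ℤ) (h : c p < b (p + 1)) :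
    HasInterval a c S := by
  have := ha p; have := hb p; have := hc p; have := hac p
  by_cases h' : a (p + 1) = c (p + 1) → ¬DropBoth a c p
  · exact hasInterval_of_lt ha hb hc hac hN hS p h' (by omega) (by omega)
  · push Not at h'
    obtain ⟨he, _, _⟩ := h'
    exact hasInterval_of_add_one_lt ha hb hc hac hN hS (p + 1) (by omega) (by omega)

theorem hasInterval_of_not_interlaced {a b c : ℤ → ℤ} {S : ℤ → Prop} {N : ℤ} (ha : IsStair a)
    (hb : IsStair b) (hc : IsStair c) (hac : Interlaced a c) (hN : ∀ t, N ≤ t → b t = a t)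
    (hN' : ∀ t, t ≤ -N → b t = a t) (hS : ∀ t, a t < b t → c t < b t → S t)
    (hS' : ∀ t, b t < a t → b t < c t → S t) (h : ¬Interlaced b c) : HasInterval a c S := by
  simp only [Interlaced, not_forall, not_and_or, not_le] at h
  obtain ⟨p, h | h⟩ := h
  · exact hasInterval_of_gap ha hb hc hac (fun t ht => (hN t ht).le) hS p h
  · refine .of_reflect (hasInterval_of_gap (N := N) ha.reflect hb.reflect hc.reflect hac.reflect
      (fun t ht => ?_) (fun t h1 h2 => ?_) (-(p + 1)) ?_)
    · simp only [reflect, hN' (-t) (by omega), le_refl]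
    · simp only [reflect] at h1 h2
      exact hS' _ (by omega) (by omega)
    · have e : -(-(p + 1) + 1) = p := by ring
      simp only [reflect, e, neg_neg]
      omega

theorem rightEnd_of_isInterval {a b c : ℤ → ℤ} {S : ℤ → Prop} {N i j : ℤ}
    (hb : IsStair b) (hN : ∀ t, N ≤ t → b t ≤ a t)
    (hS : ∀ t, a t < b t → c t < b t → S t) (hbc : IsInterval b c i j)
    (hij : ∀ t, i < t → t ≤ j → S t) (s : ℤ) (hs : i < s) (hs' : s ≤ j) (he : a s = c s) :
    RightEnd a c S s := by
  obtain ⟨h0, h1, h2, h3, h4⟩ := hbc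
  revert hs hs' he
  induction s using int_induction_to (j + 1) with
  | h1 t ht => intros; omega
  | h2 t ih =>
    intro ht ht' he
    refine .of_succ he (hij t ht ht') fun hd => ?_
    obtain ⟨d1, d2⟩ := hd
    rcases ht'.eq_or_lt with rfl | hlt
    · have := h4 t ht le_rfl
      have := hb t
      refine rightEnd_of_lt hb hN hS _ (by omega) ?_
      by_contra hcon
      exact h2 ⟨by omega, d2⟩
    · exact ih (by omega) (by omega) (by omega)

theorem hasInterval_of_drop {a b c : ℤ → ℤ} {S : ℤ → Prop} {N i j : ℤ} (ha : IsStair a)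
    (hb : IsStair b) (hc : IsStair c) (hac : Interlaced a c) (hN : ∀ t, N ≤ t → b t ≤ a t)
    (hS : ∀ t, a t < b t → c t < b t → S t) (hbc : IsInterval b c i j) (h : a j < c j) :
    HasInterval a c S := by
  obtain ⟨h0, h1, h2, h3, h4⟩ := hbc
  have := h4 j h0 le_rfl
  have := ha j; have := hb j; have := hc j; have := hac j
  have hbj : b (j + 1) = b j := by
    by_contra hcon
    exact h2 ⟨by omega, by omega⟩
  exact hasInterval_of_lt ha hb hc hac hN hS j
    (fun _ hd => by obtain ⟨_, _⟩ := hd; omega) (by omega) (by omega)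

theorem exists_eq_of_isInterval {a b c : ℤ → ℤ} {i j : ℤ} (ha : IsStair a)
    (hbc : IsInterval b c i j) (hj : c j ≤ a j) (s : ℤ) (hs : i < s) (hs' : s ≤ j)
    (h : a s ≤ c s) : ∃ t, i < t ∧ t ≤ j ∧ a t = c t := by
  revert hs hs' h
  induction s using int_induction_to (j + 1) with
  | h1 t ht => intros; omega
  | h2 t ih =>
    intro ht ht' h
    rcases h.eq_or_lt with he | hlt
    · exact ⟨t, ht, ht', he⟩
    · have : t ≠ j := by rintro rfl; omega
      have := (hbc.2.2.2.1 t ht (by omega)).2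
      have := ha t
      exact ih (by omega) (by omega) (by omega)

theorem hasInterval_of_hasInterval {a b c : ℤ → ℤ} {S : ℤ → Prop} {N : ℤ} (ha : IsStair a)
    (hb : IsStair b) (hc : IsStair c) (hac : Interlaced a c) (hN : ∀ t, N ≤ t → b t = a t)
    (hN' : ∀ t, t ≤ -N → b t = a t) (hS : ∀ t, a t < b t → c t < b t → S t)
    (hS' : ∀ t, b t < a t → b t < c t → S t) (h : HasInterval b c S) : HasInterval a c S := by
  obtain ⟨i, j, hbc, hij⟩ := h
  have hNr : ∀ t, N ≤ t → reflect b t ≤ reflect a t := fun t ht => by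
    simp only [reflect, hN' (-t) (by omega), le_refl]
  have hSr : ∀ t, reflect a t < reflect b t → reflect c t < reflect b t → S (-t) :=
    fun t h1 h2 => by
      simp only [reflect] at h1 h2
      exact hS' _ (by omega) (by omega)
  rcases lt_or_ge (a j) (c j) with hj | hj
  · exact hasInterval_of_drop ha hb hc hac (fun t ht => (hN t ht).le) hS hbc hj
  rcases lt_or_ge (c (i + 1)) (a (i + 1)) with hi | hi
  · refine .of_reflect (hasInterval_of_drop (N := N) ha.reflect hb.reflect hc.reflect hac.reflect
      hNr hSr hbc.reflect ?_)
    have e : -(-i - 1) = i + 1 := by ring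
    simp only [reflect, e]
    omega
  obtain ⟨t, h1, h2, he⟩ := exists_eq_of_isInterval ha hbc hj (i + 1) (by omega) hbc.1 hi
  refine .of_ends (.of_reflect ?_)
    (rightEnd_of_isInterval hb (fun t ht => (hN t ht).le) hS hbc hij t h1 h2 he)
  exact rightEnd_of_isInterval hb.reflect hNr hSr hbc.reflect
    (fun u hu hu' => hij _ (by omega) (by omega)) (-t) (by omega) (by omega) (by simp [reflect, he])

/-- The number of elements of `x` that are at least `t`, as a sequence indexed by `ℤ`. -/
def height {m : ℕ} (x : Finset (Fin (m + 1))) (t : ℤ) : ℤ :=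
  (x.filter (fun a : Fin (m + 1) => t ≤ ((a : ℕ) : ℤ))).card

section Height

variable {m : ℕ} (x : Finset (Fin (m + 1)))

theorem vwt_eq_height (c : Fin m) : (vwt x c : ℤ) = height x ((c : ℕ) + 1) := by
  simp only [vwt, height]
  congr 3
  ext a
  constructor <;> intro h <;> omega

theorem height_of_mem {t : ℤ} (a : Fin (m + 1)) (hat : ((a : ℕ) : ℤ) = t) (ha : a ∈ x) :
    height x t = height x (t + 1) + 1 := by
  have : x.filter (fun b : Fin (m + 1) => t ≤ ((b : ℕ) : ℤ)) =
      insert a (x.filter (fun b : Fin (m + 1) => t + 1 ≤ ((b : ℕ) : ℤ))) := by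
    ext b
    simp only [Finset.mem_filter, Finset.mem_insert]
    constructor
    · rintro ⟨h1, h2⟩
      rcases h2.eq_or_lt with h | h
      · left; ext; omega
      · right; exact ⟨h1, h⟩
    · rintro (rfl | ⟨h1, h2⟩)
      · exact ⟨ha, by omega⟩
      · exact ⟨h1, by omega⟩
  rw [height, this, Finset.card_insert_of_notMem (by simp; omega)]
  simp [height]

theorem height_of_notMem {t : ℤ} (h : ∀ a : Fin (m + 1), ((a : ℕ) : ℤ) = t → a ∉ x) :
    height x t = height x (t + 1) := by
  simp only [height]
  congr 2
  refine Finset.filter_congr fun a ha => ?_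
  have : ((a : ℕ) : ℤ) ≠ t := fun h' => h a h' ha
  omega

theorem mem_iff_height (a : Fin (m + 1)) {t : ℤ} (hat : ((a : ℕ) : ℤ) = t) :
    a ∈ x ↔ height x t = height x (t + 1) + 1 := by
  refine ⟨height_of_mem x a hat, fun h => ?_⟩
  by_contra hcon
  have := height_of_notMem x (t := t) fun b hb => by
    obtain rfl : b = a := by ext; omega
    exact hcon
  omega

theorem isStair_height : IsStair (height x) := by
  intro t
  by_cases h : ∃ a ∈ x, ((a : ℕ) : ℤ) = t
  · obtain ⟨a, ha, hat⟩ := h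
    have := height_of_mem x a hat ha
    omega
  · push Not at h
    have := height_of_notMem x fun a hat ha => h a ha hat
    omega

theorem height_of_nonpos {t : ℤ} (ht : t ≤ 0) : height x t = x.card := by
  rw [height, Finset.filter_true_of_mem fun a _ => by omega]

theorem height_of_lt {t : ℤ} (ht : (m : ℤ) < t) : height x t = 0 := by
  rw [height, Finset.filter_false_of_mem fun a _ => by omega]
  simp

end Height

theorem exists_height_eq {m k : ℕ} {f : ℤ → ℤ} (hf : IsStair f) (h0 : ∀ t ≤ 0, f t = k)
    (h1 : ∀ t, (m : ℤ) < t → f t = 0) : ∃ x : IdemState m k, height x.1 = f := by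
  let x : Finset (Fin (m + 1)) :=
    Finset.univ.filter fun a => f ((a : ℕ) : ℤ) = f (((a : ℕ) : ℤ) + 1) + 1
  have key : ∀ t, height x t = f t := fun t => by
    induction t using int_induction_to ((m : ℤ) + 1) with
    | h1 t ht => rw [height_of_lt x (by omega), h1 t (by omega)]
    | h2 t ih =>
      rcases lt_or_ge t 0 with ht | ht
      · rw [h0 t (by omega), ← h0 (t + 1) (by omega), ← ih, height_of_nonpos x (by omega),
          height_of_nonpos x (by omega)]
      · rcases lt_or_ge (m : ℤ) t with ht' | ht'
        · rw [height_of_lt x (by omega), h1 t (by omega)]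
        · lift t to ℕ using ht
          have hm := mem_iff_height x ⟨t, by omega⟩ (t := t) rfl
          have hs := isStair_height x t
          have hs' := hf t
          simp only [x, Finset.mem_filter, Finset.mem_univ, true_and] at hm
          change _ ↔ height x t = height x (t + 1) + 1 at hm
          omega
  refine ⟨⟨x, ?_⟩, funext key⟩
  have := key 0
  rw [h0 0 le_rfl, height_of_nonpos x le_rfl] at this
  exact_mod_cast this

section States

variable {m k : ℕ}

theorem height_state_of_nonpos (x : IdemState m k) {t : ℤ} (ht : t ≤ 0) : height x.1 t = k := by
  rw [height_of_nonpos _ ht, x.2]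

theorem wnum_eq_height (x y : Finset (Fin (m + 1))) (c : Fin m) :
    wnum x y c = (height x ((c : ℕ) + 1) - height y ((c : ℕ) + 1)).natAbs := by
  rw [wnum, vwt_eq_height, vwt_eq_height]

theorem texp_eq_zero {x y z : IdemState m k} {c : Fin m}
    (h : (height x.1 ((c : ℕ) + 1) ≤ height y.1 ((c : ℕ) + 1) ∧
        height y.1 ((c : ℕ) + 1) ≤ height z.1 ((c : ℕ) + 1)) ∨
      (height z.1 ((c : ℕ) + 1) ≤ height y.1 ((c : ℕ) + 1) ∧
        height y.1 ((c : ℕ) + 1) ≤ height x.1 ((c : ℕ) + 1))) : texp x y z c = 0 := by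
  simp only [texp, wnum_eq_height]
  omega

theorem texp_pos {x y z : IdemState m k} {c : Fin m}
    (h : (height x.1 ((c : ℕ) + 1) < height y.1 ((c : ℕ) + 1) ∧
        height z.1 ((c : ℕ) + 1) < height y.1 ((c : ℕ) + 1)) ∨
      (height y.1 ((c : ℕ) + 1) < height x.1 ((c : ℕ) + 1) ∧
        height y.1 ((c : ℕ) + 1) < height z.1 ((c : ℕ) + 1))) : 0 < texp x y z c := by
  simp only [texp, wnum_eq_height]
  omega

theorem texp_comm (x y z : IdemState m k) (c : Fin m) : texp x y z c = texp z y x c := by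
  simp only [texp, wnum_eq_height]
  omega

theorem le_height_iff_orderIsoOfFin_le (x : IdemState m k) (j : Fin k) (t : ℤ) :
    t ≤ (((x.1.orderIsoOfFin x.2 j : Fin (m + 1)) : ℕ) : ℤ) ↔ (k : ℤ) - j ≤ height x.1 t := by
  set e := x.1.orderIsoOfFin x.2 with he
  have hcard : (x.1.filter (fun a : Fin (m + 1) => t ≤ ((a : ℕ) : ℤ))).card =
      (Finset.univ.filter fun n : Fin k => t ≤ (((e n : Fin (m + 1)) : ℕ) : ℤ)).card := by
    symm
    refine Finset.card_bij (fun n _ => (e n : Fin (m + 1))) ?_ ?_ ?_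
    · intro n hn
      simpa using hn
    · intro n _ n' _ h
      exact e.injective (Subtype.ext h)
    · intro a ha
      rw [Finset.mem_filter] at ha
      exact ⟨e.symm ⟨a, ha.1⟩, by simpa using ha.2, by simp⟩
  have hmono : ∀ {n n' : Fin k}, n ≤ n' →
      ((e n : Fin (m + 1)) : ℕ) ≤ ((e n' : Fin (m + 1)) : ℕ) := fun h => e.monotone h
  rw [height, hcard]
  constructor
  · intro h
    have : Finset.Ici j ⊆
        Finset.univ.filter fun n : Fin k => t ≤ (((e n : Fin (m + 1)) : ℕ) : ℤ) := fun n hn => by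
      have := hmono (Finset.mem_Ici.1 hn)
      simp only [Finset.mem_filter, Finset.mem_univ, true_and]
      omega
    have := Finset.card_le_card this
    rw [Fin.card_Ici] at this
    omega
  · intro h
    by_contra hcon
    have : (Finset.univ.filter fun n : Fin k => t ≤ (((e n : Fin (m + 1)) : ℕ) : ℤ)) ⊆
        Finset.Ioi j := fun n hn => by
      simp only [Finset.mem_filter, Finset.mem_univ, true_and] at hn
      rw [Finset.mem_Ioi]
      by_contra hn'
      have := hmono (not_lt.1 hn')
      omega
    have := Finset.card_le_card this
    rw [Fin.card_Ioi] at this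
    omega

theorem exists_add_one_lt_iff (x y : IdemState m k) :
    (∃ j : Fin k, (((y.1.orderIsoOfFin y.2 j : Fin (m + 1)) : ℕ) : ℤ) + 1 <
        (((x.1.orderIsoOfFin x.2 j : Fin (m + 1)) : ℕ) : ℤ)) ↔
      ∃ t, height y.1 t < height x.1 (t + 1) := by
  constructor
  · rintro ⟨j, hj⟩
    refine ⟨(((y.1.orderIsoOfFin y.2 j : Fin (m + 1)) : ℕ) : ℤ) + 1, ?_⟩
    have h1 := (le_height_iff_orderIsoOfFin_le x j
      ((((y.1.orderIsoOfFin y.2 j : Fin (m + 1)) : ℕ) : ℤ) + 1 + 1)).1 (by omega)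
    have h2 := (le_height_iff_orderIsoOfFin_le y j
      ((((y.1.orderIsoOfFin y.2 j : Fin (m + 1)) : ℕ) : ℤ) + 1)).not.1 (by omega)
    omega
  · rintro ⟨t, ht⟩
    have h0 : 0 ≤ height y.1 t := by simp [height]
    have hk : height x.1 (t + 1) ≤ k := by
      have := Finset.card_filter_le x.1 fun a : Fin (m + 1) => t + 1 ≤ ((a : ℕ) : ℤ)
      rw [x.2] at this
      rw [height]
      exact_mod_cast this
    let j : Fin k := ⟨k - 1 - (height y.1 t).toNat, by omega⟩
    have hj : ((j : ℕ) : ℤ) = k - 1 - height y.1 t := by simp only [j]; omega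
    have h1 := (le_height_iff_orderIsoOfFin_le x j (t + 1)).2 (by omega)
    have h2 := (le_height_iff_orderIsoOfFin_le y j t).not.2 (by omega)
    exact ⟨j, by omega⟩

theorem farStates_iff (x y : IdemState m k) :
    FarStates x y ↔ ¬Interlaced (height x.1) (height y.1) := by
  have h1 := exists_add_one_lt_iff x y
  have h2 := exists_add_one_lt_iff y x
  simp only [Interlaced, not_forall, not_and_or, not_le, exists_or, ← h1, ← h2, FarStates,
    lt_abs]
  refine or_congr (exists_congr fun j => ?_) (exists_congr fun j => ?_) <;>
    constructor <;> intro h <;> omega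

theorem dropBoth_height_iff (x y : IdemState m k) (a : Fin (m + 1)) {t : ℤ}
    (hat : ((a : ℕ) : ℤ) = t) : DropBoth (height x.1) (height y.1) t ↔ a ∈ x.1 ∧ a ∈ y.1 := by
  rw [DropBoth, ← mem_iff_height x.1 a hat, ← mem_iff_height y.1 a hat]

theorem genInterval_iff (x y : IdemState m k) (i j : ℕ) :
    GenInterval x y i j ↔ j ≤ m ∧ IsInterval (height x.1) (height y.1) i j := by
  constructor
  · rintro ⟨h0, h1, h2, h3, h4⟩
    refine ⟨h1, by omega, ?_, ?_, fun t ht ht' => ?_, fun t ht ht' => ?_⟩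
    · rw [dropBoth_height_iff x y ⟨i, by omega⟩ rfl]
      exact h2 _ (.inl rfl)
    · rw [dropBoth_height_iff x y ⟨j, by omega⟩ rfl]
      exact h2 _ (.inr rfl)
    · lift t to ℕ using by omega
      rw [dropBoth_height_iff x y ⟨t, by omega⟩ rfl]
      exact h3 _ (by simpa using ht) (by simpa using ht')
    · obtain ⟨n, rfl⟩ : ∃ n : ℕ, t = n + 1 := ⟨(t - 1).toNat, by omega⟩
      have := h4 ⟨n, by omega⟩ (by simp; omega) (by simp; omega)
      rw [wnum_eq_height] at this
      dsimp only at this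
      omega
  · rintro ⟨h1, h0, h2, h2', h3, h4⟩
    refine ⟨by omega, h1, fun a ha => ?_, fun a ha ha' => ?_, fun c hc hc' => ?_⟩
    · rw [← dropBoth_height_iff x y a rfl]
      rcases ha with ha | ha <;> rwa [ha]
    · rw [← dropBoth_height_iff x y a rfl]
      exact h3 _ (by omega) (by omega)
    · rw [wnum_eq_height]
      have := h4 ((c : ℕ) + 1) (by omega) (by omega)
      omega

/-- The positions at which an exponent vector is positive. -/
def PosAt (s : Fin m → ℕ) (t : ℤ) : Prop := ∃ c : Fin m, ((c : ℕ) : ℤ) + 1 = t ∧ 0 < s c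

/-- The monomial `U^s` lies in `I(x, y)`. -/
def InIdeal (x y : IdemState m k) (s : Fin m → ℕ) : Prop :=
  ¬Interlaced (height x.1) (height y.1) ∨ HasInterval (height x.1) (height y.1) (PosAt s)

theorem Interlaced.symm {a c : ℤ → ℤ} (h : Interlaced a c) : Interlaced c a :=
  fun t => (h t).symm

theorem IsInterval.symm {a c : ℤ → ℤ} {i j : ℤ} (h : IsInterval a c i j) : IsInterval c a i j :=
  ⟨h.1, fun h' => h.2.1 h'.symm, fun h' => h.2.2.1 h'.symm,
    fun t ht ht' => (h.2.2.2.1 t ht ht').symm, fun t ht ht' => (h.2.2.2.2 t ht ht').symm⟩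

theorem InIdeal.symm {x y : IdemState m k} {s : Fin m → ℕ} (h : InIdeal x y s) :
    InIdeal y x s := by
  rcases h with h | ⟨i, j, h, hS⟩
  exacts [.inl fun h' => h h'.symm, .inr ⟨i, j, h.symm, hS⟩]

theorem posAt_of_texp_pos {x y z : IdemState m k} {s : Fin m → ℕ} (hs : ∀ c, texp x y z c ≤ s c)
    {t : ℤ} (h : (height x.1 t < height y.1 t ∧ height z.1 t < height y.1 t) ∨
      (height y.1 t < height x.1 t ∧ height y.1 t < height z.1 t)) : PosAt s t := by
  have h0 : 0 < t := by
    by_contra hcon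
    rw [height_state_of_nonpos x (by omega), height_state_of_nonpos y (by omega)] at h
    omega
  have h1 : t ≤ m := by
    by_contra hcon
    rw [height_of_lt x.1 (by omega), height_of_lt y.1 (by omega)] at h
    omega
  obtain ⟨n, rfl⟩ : ∃ n : ℕ, t = n + 1 := ⟨(t - 1).toNat, by omega⟩
  let c : Fin m := ⟨n, by omega⟩
  exact ⟨c, rfl, (texp_pos (c := c) h).trans_le (hs c)⟩

theorem InIdeal.mul_left {x y z : IdemState m k} {s s' : Fin m → ℕ} (h : InIdeal y z s)
    (hs : ∀ c, s c + texp x y z c ≤ s' c) : InIdeal x z s' := by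
  rw [InIdeal, or_iff_not_imp_left, not_not]
  intro hac
  have hS : ∀ t, height x.1 t < height y.1 t → height z.1 t < height y.1 t → PosAt s' t :=
    fun t h1 h2 => posAt_of_texp_pos (fun c => le_of_add_le_right (hs c)) (.inl ⟨h1, h2⟩)
  have hS' : ∀ t, height y.1 t < height x.1 t → height y.1 t < height z.1 t → PosAt s' t :=
    fun t h1 h2 => posAt_of_texp_pos (fun c => le_of_add_le_right (hs c)) (.inr ⟨h1, h2⟩)
  have hN : ∀ t, (m : ℤ) + 1 ≤ t → height y.1 t = height x.1 t := fun t ht => by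
    rw [height_of_lt _ (by omega), height_of_lt _ (by omega)]
  have hN' : ∀ t, t ≤ -((m : ℤ) + 1) → height y.1 t = height x.1 t := fun t ht => by
    rw [height_state_of_nonpos _ (by omega), height_state_of_nonpos _ (by omega)]
  rcases h with h | ⟨i, j, h, hij⟩
  · exact hasInterval_of_not_interlaced (isStair_height _) (isStair_height _) (isStair_height _)
      hac hN hN' hS hS' h
  · refine hasInterval_of_hasInterval (isStair_height _) (isStair_height _) (isStair_height _)
      hac hN hN' hS hS' ⟨i, j, h, fun t ht ht' => ?_⟩
    obtain ⟨c, hc, hpos⟩ := hij t ht ht'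
    exact ⟨c, hc, hpos.trans_le (le_of_add_le_left (hs c))⟩

theorem InIdeal.mul_right {x y z : IdemState m k} {s s' : Fin m → ℕ} (h : InIdeal x y s)
    (hs : ∀ c, s c + texp x y z c ≤ s' c) : InIdeal x z s' :=
  (h.symm.mul_left fun c => by rw [texp_comm]; exact hs c).symm

end States

section Factor

variable {m k : ℕ}

/-- `u` is obtained from `z` by moving an element from `r` to `p`. -/
def IsShift (z u : Finset (Fin (m + 1))) (r p : Fin (m + 1)) : Prop :=
  r ∈ z ∧ p ∉ z ∧ u = insert p (z.erase r)

theorem IsShift.symm {z u : Finset (Fin (m + 1))} {r p : Fin (m + 1)} (h : IsShift z u r p) :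
    IsShift u z p r := by
  obtain ⟨hr, hp, rfl⟩ := h
  have hne : p ≠ r := by rintro rfl; exact hp hr
  refine ⟨Finset.mem_insert_self _ _, by simp [hne.symm], ?_⟩
  rw [Finset.erase_insert (by simp [hp]), Finset.insert_erase hr]

theorem isShift_of_height {z u : Finset (Fin (m + 1))} (i : Fin m)
    (h0 : height z (i : ℕ) = height z ((i : ℕ) + 1))
    (h1 : height z ((i : ℕ) + 1) = height z ((i : ℕ) + 2) + 1)
    (hu : ∀ t : ℤ, t ≠ (i : ℕ) + 1 → height u t = height z t)
    (hu' : height u ((i : ℕ) + 1) + 1 = height z ((i : ℕ) + 1)) :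
    IsShift z u i.succ i.castSucc := by
  have e : ((i : ℕ) : ℤ) + 1 + 1 = (i : ℕ) + 2 := by ring
  have a0 := hu (i : ℕ) (by omega)
  have a2 := hu ((i : ℕ) + 2) (by omega)
  refine ⟨?_, ?_, ?_⟩
  · rw [mem_iff_height z i.succ (t := (i : ℕ) + 1) (by simp), e]
    omega
  · rw [mem_iff_height z i.castSucc (t := (i : ℕ)) (by simp)]
    omega
  · ext a
    rw [mem_iff_height u a rfl, Finset.mem_insert, Finset.mem_erase, mem_iff_height z a rfl]
    rcases eq_or_ne a i.castSucc with rfl | h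
    · simp only [Fin.val_castSucc, true_or, iff_true]
      omega
    rcases eq_or_ne a i.succ with rfl | h'
    · simp only [h, Fin.val_succ, Nat.cast_add, Nat.cast_one, e, ne_eq, not_true, false_and,
        false_or, iff_false]
      omega
    · have b1 : ((a : ℕ) : ℤ) ≠ (i : ℕ) := fun hh => h (Fin.ext (by simpa using hh))
      have b2 : ((a : ℕ) : ℤ) ≠ (i : ℕ) + 1 := fun hh => h' (Fin.ext (by simp; omega))
      rw [hu _ b2, hu (((a : ℕ) : ℤ) + 1) (by omega)]
      simp [h, h']

/-- `q` lies weakly between `p` and `r`. -/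
def Betw (p q r : ℤ) : Prop := (p ≤ q ∧ q ≤ r) ∨ (r ≤ q ∧ q ≤ p)

/-- The median of the sequences `a`, `c` and the step from `n + 1` to `n` just after `e`. -/
def clip (a c : ℤ → ℤ) (n e t : ℤ) : ℤ :=
  max (min (a t) (c t)) (min (max (a t) (c t)) (if t ≤ e then n + 1 else n))

theorem isStair_clip {a c : ℤ → ℤ} (ha : IsStair a) (hc : IsStair c) (n e : ℤ) :
    IsStair (clip a c n e) := by
  intro t
  have := ha t
  have := hc t
  simp only [clip]
  split_ifs <;> omega

theorem exists_height_eq_clip (x y : IdemState m k) (n e : ℤ) :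
    ∃ z : IdemState m k, height z.1 = clip (height x.1) (height y.1) n e := by
  refine exists_height_eq (isStair_clip (isStair_height _) (isStair_height _) n e)
    (fun t ht => ?_) (fun t ht => ?_)
  · rw [clip, height_state_of_nonpos x ht, height_state_of_nonpos y ht]
    omega
  · rw [clip, height_of_lt x.1 ht, height_of_lt y.1 ht]
    omega

/-- A pair of states with a gap factors through two consecutive left shifts of one element. -/
theorem exists_factor_of_gap {x y : IdemState m k} {q : ℤ} (h : height y.1 q < height x.1 (q + 1)) :
    ∃ (z u w : IdemState m k) (i i' : Fin m), (i' : ℕ) = (i : ℕ) + 1 ∧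
      IsShift z.1 u.1 i'.succ i'.castSucc ∧ IsShift u.1 w.1 i.succ i.castSucc ∧
      ∀ t, Betw (height x.1 t) (height z.1 t) (height w.1 t) ∧
        Betw (height z.1 t) (height u.1 t) (height w.1 t) ∧
        Betw (height x.1 t) (height w.1 t) (height y.1 t) := by
  have hx := isStair_height x.1
  have hy := isStair_height y.1
  have hq : 0 < q := by
    by_contra hcon
    have := hx q
    rw [height_state_of_nonpos x (t := q) (by omega)] at this
    rw [height_state_of_nonpos y (t := q) (by omega)] at h
    omega
  have hqm : q < m := by
    by_contra hcon
    rw [height_of_lt x.1 (t := q + 1) (by omega)] at h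
    have : 0 ≤ height y.1 q := by simp [height]
    omega
  obtain ⟨i, rfl⟩ : ∃ i : ℕ, q = i + 1 := ⟨(q - 1).toNat, by omega⟩
  have e : (i : ℤ) + 1 + 1 = i + 2 := by ring
  have e' : (i : ℤ) + 2 + 1 = i + 3 := by ring
  obtain ⟨z, hz⟩ := exists_height_eq_clip x y (height y.1 (i + 1)) (i + 2)
  obtain ⟨u, hu⟩ := exists_height_eq_clip x y (height y.1 (i + 1)) (i + 1)
  obtain ⟨w, hw⟩ := exists_height_eq_clip x y (height y.1 (i + 1)) i
  have x0 := hx i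
  have x1 := hx (i + 1)
  have x2 := hx (i + 2)
  have y0 := hy i
  have y1 := hy (i + 1)
  have y2 := hy (i + 2)
  rw [e] at h x1 y1
  rw [e'] at x2 y2
  refine ⟨z, u, w, ⟨i, by omega⟩, ⟨i + 1, by omega⟩, rfl, ?_, ?_, fun t => ?_⟩
  · have e1 : (i : ℤ) + 1 + 2 = i + 3 := by ring
    apply isShift_of_height <;> simp only [hz, hu, clip] <;> push_cast <;> simp only [e, e1]
    · split_ifs <;> omega
    · split_ifs <;> omega
    · intro t ht
      split_ifs <;> omega
    · split_ifs <;> omega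
  · apply isShift_of_height <;> simp only [hu, hw, clip]
    · split_ifs <;> omega
    · split_ifs <;> omega
    · intro t ht
      split_ifs <;> omega
    · split_ifs <;> omega
  · simp only [Betw, hz, hu, hw, clip]
    rcases eq_or_ne t (i + 1) with rfl | h1
    · split_ifs <;> omega
    rcases eq_or_ne t (i + 2) with rfl | h2
    · split_ifs <;> omega
    · split_ifs <;> omega

/-- The sequence between `a` and `c` outside a generating interval, lowered by one inside it. -/
def lowered (a c : ℤ → ℤ) (i j t : ℤ) : ℤ :=
  if t ≤ i then min (a t) (c t) else if t < j then a t - 1 else max (a t) (c t)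

theorem isStair_lowered {a c : ℤ → ℤ} (ha : IsStair a) (hc : IsStair c) {i j : ℤ}
    (h : IsInterval a c i j) : IsStair (lowered a c i j) := by
  intro t
  obtain ⟨h0, h1, h2, h3, h4⟩ := h
  simp only [DropBoth] at h1 h2 h3
  have := ha t
  have := hc t
  have := h3 t
  have := h4 t
  have := h4 (t + 1)
  simp only [lowered]
  rcases eq_or_ne t i with rfl | hi
  · split_ifs <;> omega
  · rcases eq_or_ne t j with rfl | hj <;> split_ifs <;> omega

theorem exists_factor_of_isInterval {x y : IdemState m k} {i j : ℤ} (hi : 0 ≤ i) (hj : j ≤ m)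
    (h : IsInterval (height x.1) (height y.1) i j) :
    ∃ (z : IdemState m k) (p : Fin m), ((p : ℕ) : ℤ) + 1 = j ∧
      p.castSucc ∉ z.1 ∧ p.succ ∉ z.1 ∧
      (∀ t, i < t → t < j → height z.1 t + 1 = height x.1 t ∧ height x.1 t = height y.1 t) ∧
      ∀ t, (t ≤ i ∨ j ≤ t) → Betw (height x.1 t) (height z.1 t) (height y.1 t) := by
  have hx := isStair_height x.1
  have hy := isStair_height y.1
  obtain ⟨z, hz⟩ := exists_height_eq (m := m) (k := k) (isStair_lowered hx hy h)
    (fun t ht => by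
      rw [lowered, if_pos (by omega), height_state_of_nonpos x ht, height_state_of_nonpos y ht]
      omega)
    (fun t ht => by
      rw [lowered, if_neg (by have := h.1; omega), if_neg (by omega), height_of_lt x.1 ht,
        height_of_lt y.1 ht]
      omega)
  obtain ⟨h0, h1, h2, h3, h4⟩ := h
  simp only [DropBoth] at h1 h2 h3
  obtain ⟨p, rfl⟩ : ∃ p : ℕ, j = p + 1 := ⟨(j - 1).toNat, by omega⟩
  refine ⟨z, ⟨p, by omega⟩, rfl, ?_, ?_, fun t ht ht' => ?_, fun t ht => ?_⟩
  · rw [mem_iff_height z.1 _ (t := p) (by simp)]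
    have := hx p
    have := hy p
    have := h3 p
    have := h4 p
    have := h4 (p + 1)
    simp only [hz, lowered]
    rcases eq_or_ne i p with rfl | hip <;> split_ifs <;> omega
  · rw [mem_iff_height z.1 _ (t := p + 1) (by simp)]
    have := hx (p + 1)
    have := hy (p + 1)
    have := h4 (p + 1)
    simp only [hz, lowered]
    split_ifs <;> omega
  · have := h4 t ht (by omega)
    simp only [hz, lowered]
    split_ifs <;> omega
  · simp only [hz, lowered, Betw]
    split_ifs <;> omega

end Factor

section Algebra

variable {m k : ℕ}

theorem mulB_add_left (f f' g : B0 m k) : mulB (f + f') g = mulB f g + mulB f' g := by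
  refine Finsupp.sum_add_index' (fun a => ?_) fun a r r' => ?_
  · refine Finset.sum_eq_zero fun b _ => ?_
    dsimp only
    split <;> simp
    rfl
  · rw [← Finsupp.sum_add]
    refine Finset.sum_congr rfl fun b _ => ?_
    dsimp only
    split
    · rw [add_mul]
      exact Finsupp.single_add _ _ _
    · simp

theorem mulB_add_right (f g g' : B0 m k) : mulB f (g + g') = mulB f g + mulB f g' := by
  simp only [mulB]
  rw [← Finsupp.sum_add]
  refine Finset.sum_congr rfl fun a _ => ?_
  refine Finsupp.sum_add_index' (fun b => ?_) fun b r r' => ?_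
  · split <;> simp
    rfl
  · split
    · rw [mul_add]
      exact Finsupp.single_add _ _ _
    · simp

noncomputable instance : NonUnitalNonAssocRing (B0 m k) :=
  { (inferInstance : AddCommGroup (B0 m k)), (inferInstance : Mul (B0 m k)) with
    left_distrib := mulB_add_right
    right_distrib := mulB_add_left
    zero_mul := fun g => by
      have h := mulB_add_left 0 0 g
      rw [add_zero] at h
      exact left_eq_add.1 h
    mul_zero := fun f => by
      have h := mulB_add_right f 0 0
      rw [add_zero] at h
      exact left_eq_add.1 h }

theorem bElt_mul_bElt' (a b : BGen m k) :
    bElt a * bElt b = match mulBGen a b with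
      | some c => bElt c
      | none => 0 := by
  change mulB (bElt a) (bElt b) = _
  rw [mulB, bElt, bElt]
  refine (Finsupp.sum_single_index ?_).trans ((Finsupp.sum_single_index ?_).trans ?_)
  · refine Finset.sum_eq_zero fun b _ => ?_
    dsimp only
    split <;> simp
    rfl
  · split <;> simp
    rfl
  · simp only [mul_one]
    rfl

theorem bElt_mul_of_ne {a b : BGen m k} (h : a.r ≠ b.l) : bElt a * bElt b = 0 := by
  rw [bElt_mul_bElt', mulBGen, if_neg h]

theorem bElt_mul (x y z : IdemState m k) (s s' : Fin m → ℕ) :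
    bElt ⟨x, y, s⟩ * bElt ⟨y, z, s'⟩ = bElt ⟨x, z, fun c => s c + s' c + texp x y z c⟩ := by
  rw [bElt_mul_bElt', mulBGen, if_pos rfl]

theorem B0.eq_sum (f : B0 m k) : f = ∑ g ∈ (B0.toF f).support, bElt g := by
  refine (Finsupp.sum_single (B0.toF f)).symm.trans (Finset.sum_congr rfl fun g hg => ?_)
  have : ∀ r : ZMod 2, r ≠ 0 → r = 1 := by decide
  rw [bElt, this _ (Finsupp.mem_support_iff.1 hg)]

theorem texp_self_left (x y : IdemState m k) (c : Fin m) : texp x x y c = 0 :=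
  texp_eq_zero (by omega)

theorem texp_self_right (x y : IdemState m k) (c : Fin m) : texp x y y c = 0 :=
  texp_eq_zero (by omega)

theorem idemElt_mul_UElt (x : IdemState m k) (j : Fin m) :
    idemElt x * UElt j = bElt ⟨x, x, fun c => if c = j then 1 else 0⟩ := by
  rw [UElt, Finset.mul_sum, Finset.sum_eq_single x]
  · rw [idemElt, bElt_mul]
    simp [texp_self_left]
  · exact fun y _ hy => bElt_mul_of_ne hy.symm
  · simp

theorem idemElt_mul_bElt_mul_idemElt (x y : IdemState m k) (s : Fin m → ℕ) :
    idemElt x * bElt ⟨x, y, s⟩ * idemElt y = bElt ⟨x, y, s⟩ := by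
  rw [idemElt, idemElt, bElt_mul, bElt_mul]
  simp [texp_self_left, texp_self_right]

theorem idemElt_mul_bElt_mul_idemElt_of_ne {x y : IdemState m k} {g : BGen m k}
    (h : ¬(g.l = x ∧ g.r = y)) : idemElt x * bElt g * idemElt y = 0 := by
  obtain ⟨l, r, s⟩ := g
  by_cases hl : l = x
  · subst hl
    rw [idemElt, idemElt, bElt_mul, bElt_mul_of_ne fun h' => h ⟨rfl, h'⟩]
  · rw [idemElt, bElt_mul_of_ne fun h' => hl h'.symm, zero_mul]

/-- The span of the basis elements `φ^{x,y}(U^s)` with `U^s ∈ I(x, y)`. -/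
noncomputable def goodSpan (m k : ℕ) : AddSubgroup (B0 m k) :=
  AddSubgroup.closure {z | ∃ g : BGen m k, InIdeal g.l g.r g.s ∧ z = bElt g}

theorem bElt_mem_goodSpan {g : BGen m k} (h : InIdeal g.l g.r g.s) : bElt g ∈ goodSpan m k :=
  AddSubgroup.subset_closure ⟨g, h, rfl⟩

theorem mul_mem_goodSpan_left (f : B0 m k) {g : B0 m k} (hg : g ∈ goodSpan m k) :
    f * g ∈ goodSpan m k := by
  rw [B0.eq_sum f, Finset.sum_mul]
  refine sum_mem fun a _ => ?_
  induction hg using AddSubgroup.closure_induction with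
  | mem z hz =>
    obtain ⟨⟨y, z, s⟩, hb, rfl⟩ := hz
    obtain ⟨x, y', s'⟩ := a
    by_cases h : y' = y
    · subst h
      rw [bElt_mul]
      exact bElt_mem_goodSpan (hb.mul_left fun c => by dsimp only; omega)
    · rw [bElt_mul_of_ne h]
      exact zero_mem _
  | zero => rw [mul_zero]; exact zero_mem _
  | add z w _ _ h1 h2 => rw [mul_add]; exact add_mem h1 h2
  | neg z _ h => rw [mul_neg]; exact neg_mem h

theorem mul_mem_goodSpan_right {f : B0 m k} (hf : f ∈ goodSpan m k) (g : B0 m k) :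
    f * g ∈ goodSpan m k := by
  rw [B0.eq_sum g, Finset.mul_sum]
  refine sum_mem fun b _ => ?_
  induction hf using AddSubgroup.closure_induction with
  | mem z hz =>
    obtain ⟨⟨x, y, s⟩, ha, rfl⟩ := hz
    obtain ⟨y', z, s'⟩ := b
    by_cases h : y = y'
    · subst h
      rw [bElt_mul]
      exact bElt_mem_goodSpan (ha.mul_right fun c => by dsimp only; omega)
    · rw [bElt_mul_of_ne h]
      exact zero_mem _
  | zero => rw [zero_mul]; exact zero_mem _
  | add z w _ _ h1 h2 => rw [add_mul]; exact add_mem h1 h2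
  | neg z _ h => rw [neg_mul]; exact neg_mem h

/-- The sum of the basis elements `φ^{x,y}(1)` over the pairs satisfying `C`. -/
noncomputable def pairSum (C : IdemState m k × IdemState m k → Prop) [DecidablePred C] : B0 m k :=
  ∑ p : IdemState m k × IdemState m k, if C p then bElt ⟨p.1, p.2, fun _ => 0⟩ else 0

theorem pairSum_mul_pairSum_mem (C D : IdemState m k × IdemState m k → Prop) [DecidablePred C]
    [DecidablePred D]
    (h : ∀ x y z, C (x, y) → D (y, z) → ¬Interlaced (height x.1) (height z.1)) :
    pairSum C * pairSum D ∈ goodSpan m k := by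
  rw [pairSum, pairSum, Finset.sum_mul_sum]
  refine sum_mem fun p _ => sum_mem fun q _ => ?_
  obtain ⟨x, y⟩ := p
  obtain ⟨y', z⟩ := q
  split_ifs with h1 h2
  · by_cases hy : y = y'
    · subst hy
      rw [bElt_mul]
      exact bElt_mem_goodSpan (.inl (h x y z h1 h2))
    · rw [bElt_mul_of_ne hy]
      exact zero_mem _
  all_goals simp

theorem bElt_mul_pairSum_mul_pairSum_mul_bElt (C D : IdemState m k × IdemState m k → Prop)
    [DecidablePred C] [DecidablePred D] {x z u w y : IdemState m k} (s : Fin m → ℕ)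
    (hC : C (z, u)) (hC' : ∀ u', C (z, u') → u' = u) (hD : D (u, w))
    (hzuw : ∀ c, texp z u w c = 0) (hxzw : ∀ c, texp x z w c = 0)
    (hxwy : ∀ c, texp x w y c = 0) :
    bElt ⟨x, z, s⟩ * (pairSum C * pairSum D) * bElt ⟨w, y, fun _ => 0⟩ = bElt ⟨x, y, s⟩ := by
  rw [pairSum, pairSum, Finset.sum_mul_sum, Finset.mul_sum, Finset.sum_mul,
    Finset.sum_eq_single (z, u)]
  · rw [Finset.mul_sum, Finset.sum_mul, Finset.sum_eq_single (u, w)]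
    · rw [if_pos hC, if_pos hD, bElt_mul, bElt_mul, bElt_mul]
      simp [hzuw, hxzw, hxwy]
    · rintro ⟨u', w'⟩ - hne
      rw [if_pos hC]
      by_cases hu : u = u'
      · subst hu
        by_cases hw : w' = w
        · exact absurd (by rw [hw]) hne
        · split_ifs
          · rw [bElt_mul, bElt_mul, bElt_mul_of_ne hw]
          · simp
      · split_ifs
        · rw [bElt_mul_of_ne hu]
          simp
        · simp
    · simp
  · rintro ⟨z', u'⟩ - hne
    rw [Finset.mul_sum, Finset.sum_mul]
    refine Finset.sum_eq_zero fun q _ => ?_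
    obtain ⟨u'', w'⟩ := q
    split_ifs with h1 h2
    · by_cases hu : u' = u''
      · subst hu
        rw [bElt_mul]
        by_cases hz : z = z'
        · subst hz
          exact absurd (by rw [hC' u' h1]) hne
        · rw [bElt_mul_of_ne hz, zero_mul]
      · rw [bElt_mul_of_ne hu]
        simp
    all_goals simp
  · simp

theorem IsShift.height_eq {z u : Finset (Fin (m + 1))} {i : Fin m}
    (h : IsShift z u i.succ i.castSucc) : height u ((i : ℕ) + 2) = height z ((i : ℕ) + 2) := by
  obtain ⟨_, _, rfl⟩ := h
  simp only [height]
  congr 2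
  ext a
  simp only [Finset.mem_filter, Finset.mem_insert, Finset.mem_erase]
  constructor
  · rintro ⟨rfl | ⟨_, h⟩, h'⟩
    · simp only [Fin.val_castSucc] at h'; omega
    · exact ⟨h, h'⟩
  · rintro ⟨h, h'⟩
    refine ⟨.inr ⟨?_, h⟩, h'⟩
    rintro rfl
    simp only [Fin.val_succ] at h'; omega

theorem not_interlaced_of_isShift {x y z : Finset (Fin (m + 1))} {i i' : Fin m}
    (hi : (i' : ℕ) = (i : ℕ) + 1) (h : IsShift x y i'.succ i'.castSucc)
    (h' : IsShift y z i.succ i.castSucc) : ¬Interlaced (height x) (height z) := by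
  intro hcon
  have e1 := h.height_eq
  have e2 := h'.height_eq
  have hs : i.succ = i'.castSucc := by ext; simp [hi]
  have hy := h.symm
  have m1 := (mem_iff_height x i'.succ (t := (i : ℕ) + 2) (by simp [hi]; ring)).1 h.1
  have m2 := (mem_iff_height y i'.succ (t := (i : ℕ) + 2) (by simp [hi]; ring)).not.1 hy.2.1
  have m3 := (mem_iff_height z i.succ (t := (i : ℕ) + 1) (by simp)).not.1 h'.symm.2.1
  have c1 := hcon ((i : ℕ) + 1)
  have s1 := isStair_height y ((i : ℕ) + 2)
  have s2 := isStair_height z ((i : ℕ) + 1)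
  have e3 : ((i' : ℕ) : ℤ) + 2 = (i : ℕ) + 2 + 1 := by rw [hi]; push_cast; ring
  have e4 : ((i : ℕ) : ℤ) + 1 + 1 = (i : ℕ) + 2 := by ring
  rw [e3] at e1
  rw [e4] at m3 c1 s2
  omega

theorem JGenerators_subset : JGenerators m k ⊆ goodSpan m k := by
  rintro g (⟨i, i', hi, rfl | rfl⟩ | ⟨j, x, h1, h2, rfl⟩)
  · exact pairSum_mul_pairSum_mem _ _ fun x y z h h' => not_interlaced_of_isShift hi h h'
  · refine pairSum_mul_pairSum_mem _ _ fun x y z h h' hcon => ?_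
    exact not_interlaced_of_isShift hi (IsShift.symm h') (IsShift.symm h) hcon.symm
  · rw [idemElt_mul_UElt]
    refine bElt_mem_goodSpan (.inr ⟨(j : ℕ), (j : ℕ) + 1,
      ⟨by omega, fun h => h1 ?_, fun h => h2 ?_, fun t _ _ => by omega, fun _ _ _ => rfl⟩,
      fun t ht ht' => ⟨j, by omega, by simp⟩⟩)
    · exact (mem_iff_height x.1 j.castSucc (by simp)).2 h.1
    · exact (mem_iff_height x.1 j.succ (by simp)).2 h.1

theorem JIdeal_le_goodSpan : JIdeal m k ≤ goodSpan m k := by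
  rw [JIdeal, AddSubgroup.closure_le]
  rintro z ⟨g, hg, a, b, rfl⟩
  exact mul_mem_goodSpan_right (mul_mem_goodSpan_left a (JGenerators_subset hg)) b

theorem mul_mul_mem_JIdeal {g : B0 m k} (hg : g ∈ JGenerators m k) (a b : B0 m k) :
    a * g * b ∈ JIdeal m k :=
  AddSubgroup.subset_closure ⟨g, hg, a, b, rfl⟩

theorem IsShift.unique {z u u' : IdemState m k} {r p : Fin (m + 1)} (h : IsShift z.1 u.1 r p)
    (h' : IsShift z.1 u'.1 r p) : u' = u :=
  Subtype.ext (h'.2.2.trans h.2.2.symm)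

theorem bElt_mem_JIdeal_of_gap {x y : IdemState m k} {q : ℤ}
    (h : height y.1 q < height x.1 (q + 1)) (s : Fin m → ℕ) : bElt ⟨x, y, s⟩ ∈ JIdeal m k := by
  obtain ⟨z, u, w, i, i', hi, h1, h2, h3⟩ := exists_factor_of_gap h
  rw [← bElt_mul_pairSum_mul_pairSum_mul_bElt
    (fun p => i'.succ ∈ p.1.1 ∧ i'.castSucc ∉ p.1.1 ∧
      p.2.1 = insert i'.castSucc (p.1.1.erase i'.succ))
    (fun p => i.succ ∈ p.1.1 ∧ i.castSucc ∉ p.1.1 ∧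
      p.2.1 = insert i.castSucc (p.1.1.erase i.succ)) s h1 (fun u' h' => IsShift.unique h1 h') h2
    (fun c => texp_eq_zero (h3 _).2.1) (fun c => texp_eq_zero (h3 _).1)
    (fun c => texp_eq_zero (h3 _).2.2)]
  exact mul_mul_mem_JIdeal (.inl ⟨i, i', hi, .inl rfl⟩) _ _

theorem bElt_mem_JIdeal_of_gap' {x y : IdemState m k} {q : ℤ}
    (h : height x.1 q < height y.1 (q + 1)) (s : Fin m → ℕ) : bElt ⟨x, y, s⟩ ∈ JIdeal m k := by
  obtain ⟨z, u, w, i, i', hi, h1, h2, h3⟩ := exists_factor_of_gap h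
  rw [← bElt_mul_pairSum_mul_pairSum_mul_bElt
    (fun p => i.castSucc ∈ p.1.1 ∧ i.succ ∉ p.1.1 ∧
      p.2.1 = insert i.succ (p.1.1.erase i.castSucc))
    (fun p => i'.castSucc ∈ p.1.1 ∧ i'.succ ∉ p.1.1 ∧
      p.2.1 = insert i'.succ (p.1.1.erase i'.castSucc)) s h2.symm
    (fun u' h' => IsShift.unique h2.symm h') h1.symm
    (z := w) (x := x) (y := y) (w := z) (fun c => ?_) (fun c => ?_) (fun c => ?_)]
  · exact mul_mul_mem_JIdeal (.inl ⟨i, i', hi, .inr rfl⟩) _ _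
  all_goals
    obtain ⟨a1, a2, a3⟩ := h3 ((c : ℕ) + 1)
    simp only [Betw] at a1 a2 a3
    exact texp_eq_zero (by omega)

theorem bElt_mem_JIdeal {x y : IdemState m k} {s : Fin m → ℕ} (h : InIdeal x y s) :
    bElt ⟨x, y, s⟩ ∈ JIdeal m k := by
  rcases h with h | ⟨i, j, h, hS⟩
  · simp only [Interlaced, not_forall, not_and_or, not_le] at h
    obtain ⟨q, h | h⟩ := h
    exacts [bElt_mem_JIdeal_of_gap h s, bElt_mem_JIdeal_of_gap' h s]
  · have hi : 0 ≤ i := by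
      obtain ⟨c, hc, -⟩ := hS (i + 1) (by omega) (by have := h.1; omega)
      omega
    have hj : j ≤ m := by
      obtain ⟨c, hc, -⟩ := hS j h.1 le_rfl
      omega
    obtain ⟨z, p, hp, h1, h2, h3, h4⟩ := exists_factor_of_isInterval hi hj h
    have hle : ∀ c, (if c = p then 1 else 0) + texp x z y c ≤ s c := fun c => by
      by_cases hc : i < (c : ℕ) + 1 ∧ ((c : ℕ) : ℤ) + 1 ≤ j
      · obtain ⟨c', hc', hpos⟩ := hS _ hc.1 hc.2
        obtain rfl : c' = c := by ext; omega
        rcases eq_or_ne c' p with rfl | hne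
        · rw [if_pos rfl, texp_eq_zero (h4 _ (.inr hp.ge))]
          exact hpos
        · have := Fin.val_ne_of_ne hne
          have := h3 ((c' : ℕ) + 1) hc.1 (by omega)
          rw [if_neg hne]
          simp only [texp, wnum_eq_height]
          omega
      · rw [if_neg (by rintro rfl; have := h.1; omega), texp_eq_zero (h4 _ (by omega))]
        omega
    have key : bElt ⟨x, y, s⟩ =
        bElt ⟨x, z, fun c => s c - ((if c = p then 1 else 0) + texp x z y c)⟩ *
          (idemElt z * UElt p) * bElt ⟨z, y, fun _ => 0⟩ := by
      rw [idemElt_mul_UElt, bElt_mul, bElt_mul]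
      congr 2
      funext c
      have := hle c
      rw [texp_self_right]
      omega
    rw [key]
    exact mul_mul_mem_JIdeal (.inr ⟨p, z, h1, h2, rfl⟩) _ _

theorem phiMap_eq_sum (x y : IdemState m k) (p : MvPolynomial (Fin m) (ZMod 2))
    {S : Finset (Fin m →₀ ℕ)} (h : p.support ⊆ S) :
    phiMap x y p =
      ∑ d ∈ S, (Finsupp.single (⟨x, y, d⟩ : BGen m k) (MvPolynomial.coeff d p) : B0 m k) := by
  refine Finset.sum_subset h fun d _ hd => ?_
  rw [MvPolynomial.notMem_support_iff.1 hd]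
  exact Finsupp.single_zero _

theorem phiMap_add (x y : IdemState m k) (p q : MvPolynomial (Fin m) (ZMod 2)) :
    phiMap x y (p + q) = phiMap x y p + phiMap x y q := by
  classical
  rw [phiMap_eq_sum x y _ MvPolynomial.support_add,
    phiMap_eq_sum x y p (S := p.support ∪ q.support) Finset.subset_union_left,
    phiMap_eq_sum x y q (S := p.support ∪ q.support) Finset.subset_union_right]
  refine Eq.trans (Finset.sum_congr rfl fun d _ => ?_) Finset.sum_add_distrib
  rw [MvPolynomial.coeff_add]
  exact Finsupp.single_add _ _ _

/-- The map `φ^{x,y}` as an additive homomorphism. -/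
noncomputable def phiHom (x y : IdemState m k) : MvPolynomial (Fin m) (ZMod 2) →+ B0 m k :=
  .mk' (phiMap x y) (phiMap_add x y)

theorem phiMap_eq_sum_bElt (x y : IdemState m k) (p : MvPolynomial (Fin m) (ZMod 2)) :
    phiMap x y p = ∑ d ∈ p.support, bElt ⟨x, y, d⟩ := by
  refine Finset.sum_congr rfl fun d hd => ?_
  have : ∀ r : ZMod 2, r ≠ 0 → r = 1 := by decide
  rw [bElt, this _ (MvPolynomial.mem_support_iff.1 hd)]

theorem support_monomial_one (d : Fin m →₀ ℕ) :
    (MvPolynomial.monomial d (1 : ZMod 2)).support = {d} := by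
  classical
  rw [MvPolynomial.support_monomial, if_neg one_ne_zero]

theorem intervalMonomial_eq (i j : ℕ) :
    (intervalMonomial i j : MvPolynomial (Fin m) (ZMod 2)) =
      MvPolynomial.monomial (∑ c ∈ Finset.univ.filter
        (fun c : Fin m => i ≤ (c : ℕ) ∧ (c : ℕ) < j), Finsupp.single c 1) 1 := by
  rw [MvPolynomial.monomial_sum_one]
  rfl

theorem sum_single_le_iff (F : Finset (Fin m)) (d : Fin m →₀ ℕ) :
    ∑ c ∈ F, Finsupp.single c 1 ≤ d ↔ ∀ c ∈ F, 0 < d c := by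
  rw [Finsupp.le_def]
  refine forall_congr' fun c => ?_
  rw [Finsupp.finsetSum_apply]
  simp only [Finsupp.single_apply, Finset.sum_ite_eq']
  split_ifs with h <;> simp [h, Nat.one_le_iff_ne_zero, Nat.pos_iff_ne_zero]

theorem hasInterval_posAt_iff (x y : IdemState m k) (d : Fin m → ℕ) :
    HasInterval (height x.1) (height y.1) (PosAt d) ↔
      ∃ i j : ℕ, GenInterval x y i j ∧ ∀ c : Fin m, i ≤ (c : ℕ) → (c : ℕ) < j → 0 < d c := by
  constructor
  · rintro ⟨i, j, h, hS⟩
    have h0 := h.1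
    obtain ⟨c, hc, -⟩ := hS (i + 1) (by omega) (by omega)
    obtain ⟨c', hc', -⟩ := hS j h0 le_rfl
    lift i to ℕ using by omega
    lift j to ℕ using by omega
    refine ⟨i, j, (genInterval_iff x y i j).2 ⟨by omega, h⟩, fun b hb hb' => ?_⟩
    obtain ⟨b', he, hpos⟩ := hS ((b : ℕ) + 1) (by omega) (by omega)
    obtain rfl : b' = b := by ext; omega
    exact hpos
  · rintro ⟨i, j, h, hd⟩
    obtain ⟨hj, h⟩ := (genInterval_iff x y i j).1 h
    refine ⟨i, j, h, fun t ht ht' => ?_⟩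
    obtain ⟨n, rfl⟩ : ∃ n : ℕ, t = n + 1 := ⟨(t - 1).toNat, by omega⟩
    exact ⟨⟨n, by omega⟩, rfl, hd _ (by simp; omega) (by simp; omega)⟩

theorem mem_IIdeal_iff (x y : IdemState m k) (p : MvPolynomial (Fin m) (ZMod 2)) :
    p ∈ IIdeal x y ↔ ∀ d ∈ p.support, InIdeal x y d := by
  by_cases hfar : FarStates x y
  · have := (farStates_iff x y).1 hfar
    simp [IIdeal, hfar, InIdeal, this]
  · have hil : Interlaced (height x.1) (height y.1) := by
      simpa [farStates_iff] using hfar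
    have hset : {q : MvPolynomial (Fin m) (ZMod 2) |
        ∃ i j : ℕ, GenInterval x y i j ∧ q = intervalMonomial i j} =
        (fun d => MvPolynomial.monomial d (1 : ZMod 2)) ''
          {d | ∃ i j : ℕ, GenInterval x y i j ∧ d = ∑ c ∈ Finset.univ.filter
            (fun c : Fin m => i ≤ (c : ℕ) ∧ (c : ℕ) < j), Finsupp.single c 1} := by
      ext q
      constructor
      · rintro ⟨i, j, h, rfl⟩
        exact ⟨_, ⟨i, j, h, rfl⟩, (intervalMonomial_eq i j).symm⟩
      · rintro ⟨_, ⟨i, j, h, rfl⟩, rfl⟩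
        exact ⟨i, j, h, (intervalMonomial_eq i j).symm⟩
    rw [IIdeal, if_neg hfar, hset, MvPolynomial.mem_ideal_span_monomial_image]
    refine forall₂_congr fun d _ => ?_
    rw [InIdeal, hasInterval_posAt_iff]
    simp only [hil, not_true, false_or]
    constructor
    · rintro ⟨_, ⟨i, j, h, rfl⟩, hle⟩
      rw [sum_single_le_iff] at hle
      exact ⟨i, j, h, fun c h1 h2 => hle c (by simp [h1, h2])⟩
    · rintro ⟨i, j, h, hd⟩
      refine ⟨_, ⟨i, j, h, rfl⟩, (sum_single_le_iff _ _).2 fun c hc => ?_⟩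
      simp only [Finset.mem_filter, Finset.mem_univ, true_and] at hc
      exact hd c hc.1 hc.2

theorem exists_phiMap_eq_of_mem_goodSpan (x y : IdemState m k) {f : B0 m k}
    (hf : f ∈ goodSpan m k) : ∃ p ∈ IIdeal x y, phiHom x y p = idemElt x * f * idemElt y := by
  induction hf using AddSubgroup.closure_induction with
  | mem z hz =>
    obtain ⟨⟨l, r, s⟩, h, rfl⟩ := hz
    by_cases hlr : l = x ∧ r = y
    · obtain ⟨rfl, rfl⟩ := hlr
      refine ⟨MvPolynomial.monomial (Finsupp.equivFunOnFinite.symm s) 1, ?_, ?_⟩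
      · rw [mem_IIdeal_iff, support_monomial_one]
        simpa using h
      · rw [idemElt_mul_bElt_mul_idemElt]
        change phiMap l r _ = _
        rw [phiMap_eq_sum_bElt, support_monomial_one, Finset.sum_singleton]
        simp
    · exact ⟨0, zero_mem _, by rw [idemElt_mul_bElt_mul_idemElt_of_ne hlr, map_zero]⟩
  | zero => exact ⟨0, zero_mem _, by simp⟩
  | add z w _ _ h1 h2 =>
    obtain ⟨p, hp, hp'⟩ := h1
    obtain ⟨q, hq, hq'⟩ := h2
    exact ⟨p + q, add_mem hp hq, by rw [map_add, hp', hq', mul_add, add_mul]⟩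
  | neg z _ h =>
    obtain ⟨p, hp, hp'⟩ := h
    exact ⟨-p, neg_mem hp, by rw [map_neg, hp', mul_neg, neg_mul]⟩

end Algebra

/-- For the two-sided ideal `J ⊆ B₀(m,k)` generated by the
elements `L_{i+1}·L_i`, `R_i·R_{i+1}` and `I_x·U_j` (for `x ∩ {j−1,j} = ∅`),
and for all idempotent states `x` and `y`:
`I_x · J · I_y = φ^{x,y}(I(x,y))`, where `I(x,y) ⊆ F₂[U_1,...,U_m]` is the
whole ring if `x` and `y` are far, and is otherwise generated by the monomials
`U_{i+1} ⋯ U_j` of the generating intervals for `(x,y)`. -/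
theorem Ix_J_Iy_eq_phi_ideal (m k : ℕ) (hk : k ≤ m + 1) (x y : IdemState m k) :
    {z : B0 m k | ∃ a ∈ JIdeal m k, z = idemElt x * a * idemElt y} =
      phiMap x y '' (IIdeal x y : Set (MvPolynomial (Fin m) (ZMod 2))) := by
  ext z
  constructor
  · rintro ⟨a, ha, rfl⟩
    exact exists_phiMap_eq_of_mem_goodSpan x y (JIdeal_le_goodSpan ha)
  · rintro ⟨p, hp, rfl⟩
    refine ⟨phiMap x y p, ?_, ?_⟩
    · rw [phiMap_eq_sum_bElt]
      exact sum_mem fun d hd => bElt_mem_JIdeal ((mem_IIdeal_iff x y p).1 hp d hd)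
    · rw [phiMap_eq_sum_bElt, Finset.mul_sum, Finset.sum_mul]
      exact Finset.sum_congr rfl fun d _ => (idemElt_mul_bElt_mul_idemElt x y d).symm
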